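/- arXiv:0807.0336 — 3 statements merged into one kernel-verified Lean document; each statement's English description precedes it below -/
import Mathlib

section
/- Let k ≥ 1, let x : Fin (2k+2) → ℝ be strictly increasing, and let γ : ℝ → EuclideanSpace ℝ (Fin (2k)) be the moment curve, γ(t) j = t^(j+1). Let {S, T} be a partition of Fin (2k+2) into two (k+1)-element subsets. Say that S and T alternate if one of S, T is the set of indices with even value and the other is the set of indices with odd value. Then: (i) if S and T do not alternate, convexHull ℝ (γ ∘ x '' S) ∩ convexHull ℝ (γ ∘ x '' T) = ∅; (ii) if S and T alternate, then convexHull ℝ (γ ∘ x '' S) ∩ convexHull ℝ (γ ∘ x '' T) is a singleton. (In the paper: for the linear map placing the vertices of a simplicial complex on the moment curve in ℝ^{2k}, the images of two disjoint k-simplices σ, τ are disjoint unless the vertices of σ and τ alternate along the moment curve, in which case the images intersect in a single point; this follows from Gale's evenness condition.) -/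
/-- The moment curve in `ℝ^m`: `γ(t) = (t, t², …, t^m)`. -/
def momentCurve (m : ℕ) (t : ℝ) : EuclideanSpace ℝ (Fin m) :=
  WithLp.toLp 2 fun j => t ^ ((j : ℕ) + 1)

open Finset Polynomial in
theorem mc_hull {ι E : Type*} [AddCommGroup E] [Module ℝ E] (f : ι → E)
    (S : Finset ι) (p : E) :
    p ∈ convexHull ℝ (f '' ↑S) ↔
      ∃ a : ι → ℝ, (∀ i ∈ S, 0 ≤ a i) ∧ ∑ i ∈ S, a i = 1 ∧ ∑ i ∈ S, a i • f i = p := by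
  classical
  constructor
  · intro hp
    have hsub : convexHull ℝ (f '' ↑S) ⊆ {p | ∃ a : ι → ℝ, (∀ i ∈ S, 0 ≤ a i) ∧
        ∑ i ∈ S, a i = 1 ∧ ∑ i ∈ S, a i • f i = p} := by
      apply convexHull_min
      · rintro _ ⟨i, hi, rfl⟩
        have hi' : i ∈ S := hi
        refine ⟨fun j => if j = i then 1 else 0, ?_, ?_, ?_⟩
        · intro j _
          dsimp only
          split_ifs <;> norm_num
        · simp [hi']
        · simp [ite_smul, hi']
      · rintro _ ⟨a, ha, ha1, rfl⟩ _ ⟨b, hb, hb1, rfl⟩ s t hs ht hst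
        refine ⟨fun i => s * a i + t * b i, ?_, ?_, ?_⟩
        · intro i hi
          have := ha i hi
          have := hb i hi
          positivity
        · rw [Finset.sum_add_distrib, ← Finset.mul_sum, ← Finset.mul_sum, ha1, hb1]
          linarith
        · simp only [add_smul, mul_smul, Finset.sum_add_distrib, Finset.smul_sum]
    exact hsub hp
  · rintro ⟨a, ha, ha1, rfl⟩
    apply (convex_convexHull ℝ _).sum_mem ha ha1
    intro i hi
    exact subset_convexHull ℝ _ ⟨i, hi, rfl⟩

/-- Barycentric weights of the nodes. -/
noncomputable def mcW {n : ℕ} (x : Fin n → ℝ) (i : Fin n) : ℝ :=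
  (∏ j ∈ Finset.univ.erase i, (x i - x j))⁻¹

theorem mcW_sign {k : ℕ} (x : Fin (2 * k + 2) → ℝ) (hx : StrictMono x) (i : Fin (2 * k + 2)) :
    0 < (-1 : ℝ) ^ (i.val + 1) * mcW x i := by
  have h1 : (∏ j ∈ Finset.univ.erase i, (if i < j then (-1 : ℝ) else 1))
      = (-1 : ℝ) ^ (i.val + 1) := by
    rw [Finset.prod_ite, Finset.prod_const_one, mul_one, Finset.prod_const]
    have : (Finset.univ.erase i).filter (fun j => i < j) = Finset.Ioi i := by
      ext j
      simp only [Finset.mem_filter, Finset.mem_erase, Finset.mem_univ, Finset.mem_Ioi]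
      constructor
      · exact fun h => h.2
      · exact fun h => ⟨⟨h.ne', trivial⟩, h⟩
    rw [this, Fin.card_Ioi]
    have hi := i.isLt
    apply neg_one_pow_congr
    simp only [Nat.even_iff]
    omega
  have h2 : 0 < ∏ j ∈ Finset.univ.erase i, ((if i < j then (-1 : ℝ) else 1) * (x i - x j)) := by
    apply Finset.prod_pos
    intro j hj
    have hne := Finset.ne_of_mem_erase hj
    split_ifs with h
    · have := hx h
      linarith
    · have := hx (lt_of_le_of_ne (not_lt.mp h) hne)
      linarith
  rw [Finset.prod_mul_distrib, h1] at h2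
  unfold mcW
  have h3 : ((-1 : ℝ) ^ (i.val + 1)) = ((-1 : ℝ) ^ (i.val + 1))⁻¹ := by
    rw [← inv_pow]; norm_num
  rw [h3, ← mul_inv]
  exact inv_pos.mpr h2

theorem mcW_sum {k : ℕ} (x : Fin (2 * k + 2) → ℝ) (hx : StrictMono x) (m : ℕ) (hm : m ≤ 2 * k) :
    ∑ i, mcW x i * x i ^ m = 0 := by
  have h := Lagrange.coeff_eq_sum (s := Finset.univ) (v := x) hx.injective.injOn
    (P := Polynomial.X ^ m) (by
      rw [Polynomial.degree_X_pow, Finset.card_univ, Fintype.card_fin]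
      exact_mod_cast (by omega : m < 2 * k + 2))
  rw [Polynomial.coeff_X_pow, Finset.card_univ, Fintype.card_fin, if_neg (by omega)] at h
  rw [h]
  apply Finset.sum_congr rfl
  intro i _
  simp [mcW, div_eq_mul_inv, mul_comm]

theorem mcW_unique {k : ℕ} (x : Fin (2 * k + 2) → ℝ) (hx : StrictMono x)
    (c : Fin (2 * k + 2) → ℝ) (hc : ∀ m ≤ 2 * k, ∑ i, c i * x i ^ m = 0) :
    ∃ l : ℝ, ∀ i, c i = l * mcW x i := by
  refine ⟨∑ i, c i * x i ^ (2 * k + 1), fun i => ?_⟩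
  have hinj : Set.InjOn x (Finset.univ : Finset (Fin (2 * k + 2))) := hx.injective.injOn
  set P := Lagrange.basis Finset.univ x i with hP
  have hd : P.natDegree = 2 * k + 1 := by
    rw [hP, Lagrange.natDegree_basis hinj (Finset.mem_univ i)]
    simp
  have hl : P.coeff (2 * k + 1) = mcW x i := by
    rw [← hd]
    exact Lagrange.leadingCoeff_basis hinj (Finset.mem_univ i)
  have h1 : ∑ j, c j * P.eval (x j) = c i := by
    rw [Finset.sum_eq_single i]
    · rw [hP, Lagrange.eval_basis_self hinj (Finset.mem_univ i), mul_one]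
    · intro j _ hj
      rw [hP, Lagrange.eval_basis_of_ne hj.symm (Finset.mem_univ j), mul_zero]
    · simp
  rw [← h1]
  simp only [Polynomial.eval_eq_sum_range, hd, Finset.mul_sum]
  rw [Finset.sum_comm, Finset.sum_range_succ, Finset.sum_eq_zero, zero_add, hl, Finset.sum_mul]
  · apply Finset.sum_congr rfl
    intros
    ring
  · intro m hm
    have := hc m (by have := Finset.mem_range.mp hm; omega)
    calc _ = P.coeff m * ∑ j, c j * x j ^ m := by
          rw [Finset.mul_sum]
          apply Finset.sum_congr rfl
          intros
          ring
      _ = 0 := by rw [this, mul_zero]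

theorem mc_comb_eq_iff {k : ℕ} (x : Fin (2 * k + 2) → ℝ) (S T : Finset (Fin (2 * k + 2)))
    (a b : Fin (2 * k + 2) → ℝ) :
    ((∑ i ∈ S, a i = ∑ i ∈ T, b i) ∧
      ∑ i ∈ S, a i • (momentCurve (2 * k) ∘ x) i = ∑ i ∈ T, b i • (momentCurve (2 * k) ∘ x) i) ↔
    ∀ m ≤ 2 * k, ∑ i ∈ S, a i * x i ^ m = ∑ i ∈ T, b i * x i ^ m := by
  constructor
  · rintro ⟨h0, h1⟩ m hm
    rcases m with _ | m
    · simpa using h0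
    · have := congrArg (fun v : EuclideanSpace ℝ (Fin (2 * k)) => v ⟨m, by omega⟩) h1
      simpa [momentCurve] using this
  · intro h
    refine ⟨by simpa using h 0 (by omega), ?_⟩
    ext j
    have := h (j.val + 1) (by have := j.isLt; omega)
    simpa [momentCurve] using this

theorem mc_key {k : ℕ} (x : Fin (2 * k + 2) → ℝ) (hx : StrictMono x)
    (S T : Finset (Fin (2 * k + 2))) (hST : Disjoint S T) (hSTu : S ∪ T = Finset.univ)
    (p : EuclideanSpace ℝ (Fin (2 * k)))
    (hpS : p ∈ convexHull ℝ ((momentCurve (2 * k) ∘ x) '' ↑S))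
    (hpT : p ∈ convexHull ℝ ((momentCurve (2 * k) ∘ x) '' ↑T)) :
    ∃ l : ℝ, (∀ i ∈ S, 0 ≤ l * mcW x i) ∧ (∀ i ∈ T, l * mcW x i ≤ 0) ∧
      ∑ i ∈ S, l * mcW x i = 1 ∧
      p = ∑ i ∈ S, (l * mcW x i) • (momentCurve (2 * k) ∘ x) i := by
  rw [mc_hull] at hpS hpT
  obtain ⟨a, ha, ha1, hap⟩ := hpS
  obtain ⟨b, hb, hb1, hbp⟩ := hpT
  have h := (mc_comb_eq_iff x S T a b).1 ⟨ha1.trans hb1.symm, hap.trans hbp.symm⟩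
  have hTS : ∀ i ∈ T, i ∉ S := fun i hi hi' => Finset.disjoint_left.mp hST hi' hi
  obtain ⟨l, hl⟩ := mcW_unique x hx (fun i => if i ∈ S then a i else - b i) (by
    intro m hm
    rw [← hSTu, Finset.sum_union hST]
    have e1 : ∑ i ∈ S, (if i ∈ S then a i else - b i) * x i ^ m = ∑ i ∈ S, a i * x i ^ m :=
      Finset.sum_congr rfl fun i hi => by rw [if_pos hi]
    have e2 : ∑ i ∈ T, (if i ∈ S then a i else - b i) * x i ^ m = - ∑ i ∈ T, b i * x i ^ m := by
      rw [← Finset.sum_neg_distrib]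
      exact Finset.sum_congr rfl fun i hi => by rw [if_neg (hTS i hi)]; ring
    rw [e1, e2, h m hm, add_neg_cancel])
  have hlS : ∀ i ∈ S, a i = l * mcW x i := fun i hi => by
    have := hl i
    rwa [if_pos hi] at this
  have hlT : ∀ i ∈ T, - b i = l * mcW x i := fun i hi => by
    have := hl i
    rwa [if_neg (hTS i hi)] at this
  refine ⟨l, fun i hi => hlS i hi ▸ ha i hi, fun i hi => ?_, ?_, ?_⟩
  · rw [← hlT i hi]
    have := hb i hi
    linarith
  · rw [← ha1]
    exact Finset.sum_congr rfl fun i hi => (hlS i hi).symm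
  · rw [← hap]
    exact Finset.sum_congr rfl fun i hi => by rw [hlS i hi]

theorem mc_exists {k : ℕ} (x : Fin (2 * k + 2) → ℝ) (hx : StrictMono x)
    (S T : Finset (Fin (2 * k + 2))) (hST : Disjoint S T) (hSTu : S ∪ T = Finset.univ)
    (hne : S.Nonempty) (e : ℝ)
    (hpos : ∀ i ∈ S, 0 < e * mcW x i) (hneg : ∀ i ∈ T, e * mcW x i < 0) :
    ∃ p, convexHull ℝ ((momentCurve (2 * k) ∘ x) '' ↑S) ∩
        convexHull ℝ ((momentCurve (2 * k) ∘ x) '' ↑T) = {p} := by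
  have hA : 0 < ∑ i ∈ S, e * mcW x i := Finset.sum_pos hpos hne
  set A := ∑ i ∈ S, e * mcW x i with hAdef
  have hm : ∀ m ≤ 2 * k, ∑ i ∈ S, (A⁻¹ * (e * mcW x i)) * x i ^ m
      = ∑ i ∈ T, (- (A⁻¹ * (e * mcW x i))) * x i ^ m := by
    intro m hm
    have := mcW_sum x hx m hm
    rw [← hSTu, Finset.sum_union hST] at this
    have e1 : ∀ U : Finset (Fin (2 * k + 2)), ∑ i ∈ U, (A⁻¹ * (e * mcW x i)) * x i ^ m
        = A⁻¹ * e * ∑ i ∈ U, mcW x i * x i ^ m := by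
      intro U
      rw [Finset.mul_sum]
      exact Finset.sum_congr rfl fun i _ => by ring
    simp only [neg_mul, Finset.sum_neg_distrib]
    rw [e1, e1]
    linear_combination A⁻¹ * e * this
  obtain ⟨h1, h2⟩ := (mc_comb_eq_iff x S T _ _).2 hm
  have h3 : ∑ i ∈ S, A⁻¹ * (e * mcW x i) = 1 := by
    rw [← Finset.mul_sum, ← hAdef, inv_mul_cancel₀ hA.ne']
  refine ⟨∑ i ∈ S, (A⁻¹ * (e * mcW x i)) • (momentCurve (2 * k) ∘ x) i, ?_⟩
  ext p
  simp only [Set.mem_inter_iff, Set.mem_singleton_iff]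
  constructor
  · rintro ⟨hpS, hpT⟩
    obtain ⟨l, -, -, hl1, hp⟩ := mc_key x hx S T hST hSTu p hpS hpT
    rw [hp]
    have hl : l = A⁻¹ * e := by
      have hA' : A = e * ∑ i ∈ S, mcW x i := by rw [hAdef, Finset.mul_sum]
      rw [← Finset.mul_sum] at hl1
      rw [eq_comm, inv_mul_eq_iff_eq_mul₀ hA.ne', hA']
      linear_combination (-e) * hl1
    exact Finset.sum_congr rfl fun i _ => by rw [hl, mul_assoc]
  · rintro rfl
    refine ⟨(mc_hull _ _ _).2 ⟨_, fun i hi => ?_, h3, rfl⟩,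
      (mc_hull _ _ _).2 ⟨_, fun i hi => ?_, h1.symm.trans h3, h2.symm⟩⟩
    · have := hpos i hi
      positivity
    · have h5 := hneg i hi
      have h6 : 0 < A⁻¹ := inv_pos.mpr hA
      nlinarith

/-- Gale's evenness condition for intersections of simplices on the moment curve:
for `2k+2` points placed on the moment curve in `ℝ^{2k}` (in increasing order of parameter)
and a partition of the indices into two `(k+1)`-sets `S`, `T`, the convex hulls of the two
point sets are disjoint unless the indices alternate (one of `S`, `T` is the set of
even-valued indices and the other the set of odd-valued ones), in which case they intersect
in a single point. -/
theorem momentCurve_simplices_intersect_iff_alternate (k : ℕ) (hk : 1 ≤ k)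
    (x : Fin (2 * k + 2) → ℝ) (hx : StrictMono x)
    (S T : Finset (Fin (2 * k + 2))) (hST : Disjoint S T) (hSTu : S ∪ T = Finset.univ)
    (hS : S.card = k + 1) (hT : T.card = k + 1) :
    (¬((S = Finset.univ.filter (fun i : Fin (2 * k + 2) => Even i.val) ∧
          T = Finset.univ.filter (fun i : Fin (2 * k + 2) => Odd i.val)) ∨
        (S = Finset.univ.filter (fun i : Fin (2 * k + 2) => Odd i.val) ∧
          T = Finset.univ.filter (fun i : Fin (2 * k + 2) => Even i.val))) →
      convexHull ℝ ((momentCurve (2 * k) ∘ x) '' ↑S) ∩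
        convexHull ℝ ((momentCurve (2 * k) ∘ x) '' ↑T) = ∅) ∧
    (((S = Finset.univ.filter (fun i : Fin (2 * k + 2) => Even i.val) ∧
          T = Finset.univ.filter (fun i : Fin (2 * k + 2) => Odd i.val)) ∨
        (S = Finset.univ.filter (fun i : Fin (2 * k + 2) => Odd i.val) ∧
          T = Finset.univ.filter (fun i : Fin (2 * k + 2) => Even i.val))) →
      ∃ p, convexHull ℝ ((momentCurve (2 * k) ∘ x) '' ↑S) ∩
        convexHull ℝ ((momentCurve (2 * k) ∘ x) '' ↑T) = {p}) := by
  have hse : ∀ i : Fin (2 * k + 2), Even i.val → mcW x i < 0 := by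
    intro i hi
    have := mcW_sign x hx i
    rw [hi.add_one.neg_one_pow] at this
    linarith
  have hso : ∀ i : Fin (2 * k + 2), Odd i.val → 0 < mcW x i := by
    intro i hi
    have := mcW_sign x hx i
    rw [hi.add_one.neg_one_pow] at this
    linarith
  have hne : S.Nonempty := Finset.card_pos.mp (by omega)
  have hcov : ∀ i, i ∈ S ∨ i ∈ T := fun i => by
    rw [← Finset.mem_union, hSTu]
    exact Finset.mem_univ i
  have hdis : ∀ i, i ∈ S → i ∉ T := fun i hi hi' => Finset.disjoint_left.mp hST hi hi'
  constructor
  · intro hnot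
    rw [Set.eq_empty_iff_forall_notMem]
    rintro p ⟨hpS, hpT⟩
    obtain ⟨l, hlS, hlT, hl1, -⟩ := mc_key x hx S T hST hSTu p hpS hpT
    apply hnot
    have hl0 : l ≠ 0 := by
      rintro rfl
      simp at hl1
    rcases lt_or_gt_of_ne hl0 with hl | hl
    · left
      have hS' : ∀ i ∈ S, Even i.val := fun i hi => by
        by_contra h
        have := hso i (Nat.not_even_iff_odd.mp h)
        have := hlS i hi
        nlinarith
      have hT' : ∀ i ∈ T, Odd i.val := fun i hi => by
        by_contra h
        have := hse i (Nat.not_odd_iff_even.mp h)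
        have := hlT i hi
        nlinarith
      constructor
      · ext i
        simp only [Finset.mem_filter, Finset.mem_univ, true_and]
        exact ⟨hS' i, fun h => (hcov i).resolve_right
          fun h' => Nat.not_even_iff_odd.mpr (hT' i h') h⟩
      · ext i
        simp only [Finset.mem_filter, Finset.mem_univ, true_and]
        exact ⟨hT' i, fun h => (hcov i).resolve_left
          fun h' => Nat.not_even_iff_odd.mpr h (hS' i h')⟩
    · right
      have hS' : ∀ i ∈ S, Odd i.val := fun i hi => by
        by_contra h
        have := hse i (Nat.not_odd_iff_even.mp h)
        have := hlS i hi
        nlinarith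
      have hT' : ∀ i ∈ T, Even i.val := fun i hi => by
        by_contra h
        have := hso i (Nat.not_even_iff_odd.mp h)
        have := hlT i hi
        nlinarith
      constructor
      · ext i
        simp only [Finset.mem_filter, Finset.mem_univ, true_and]
        exact ⟨hS' i, fun h => (hcov i).resolve_right
          fun h' => Nat.not_even_iff_odd.mpr h (hT' i h')⟩
      · ext i
        simp only [Finset.mem_filter, Finset.mem_univ, true_and]
        exact ⟨hT' i, fun h => (hcov i).resolve_left
          fun h' => Nat.not_even_iff_odd.mpr (hS' i h') h⟩
  · rintro (⟨hSe, hTe⟩ | ⟨hSe, hTe⟩)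
    · refine mc_exists x hx S T hST hSTu hne (-1) (fun i hi => ?_) (fun i hi => ?_)
      · rw [hSe, Finset.mem_filter] at hi
        have := hse i hi.2
        linarith
      · rw [hTe, Finset.mem_filter] at hi
        have := hso i hi.2
        linarith
    · refine mc_exists x hx S T hST hSTu hne 1 (fun i hi => ?_) (fun i hi => ?_)
      · rw [hSe, Finset.mem_filter] at hi
        have := hso i hi.2
        linarith
      · rw [hTe, Finset.mem_filter] at hi
        have := hse i hi.2
        linarith
end

section
/- Let k ≥ 1 and let x₀ < y₀ < x₁ < y₁ < ⋯ < x_k < y_k be real numbers. Let γ : ℝ → EuclideanSpace ℝ (Fin (2k)) be the moment curve, γ(t) j = t^(j+1). Then the determinant of the (2k) × (2k) matrix whose columns are, in this order, γ(x₁)−γ(x₀), γ(y₁)−γ(y₀), γ(x₂)−γ(x₀), γ(y₂)−γ(y₀), …, γ(x_k)−γ(x₀), γ(y_k)−γ(y₀) is strictly positive. -/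
/-- The increasing enumeration of the points. -/
noncomputable def mcPts (k : ℕ) (x y : Fin (k + 1) → ℝ) (j : Fin (2 * k + 1 + 1)) : ℝ :=
  if j.val % 2 = 0 then x ⟨j.val / 2, by have := j.isLt; omega⟩
  else y ⟨j.val / 2, by have := j.isLt; omega⟩

lemma mcPts_strictMono (k : ℕ) (x y : Fin (k + 1) → ℝ)
    (hxy : ∀ i, x i < y i)
    (hyx : ∀ i : Fin k, y i.castSucc < x i.succ) : StrictMono (mcPts k x y) := by
  rw [Fin.strictMono_iff_lt_succ]
  intro i
  have hi := i.isLt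
  rcases Nat.mod_two_eq_zero_or_one i.val with h | h
  · have h1 : (i.val + 1) % 2 = 1 := by omega
    have h2 : (i.val + 1) / 2 = i.val / 2 := by omega
    simp [mcPts, h, h1, h2, hxy]
  · have h1 : (i.val + 1) % 2 = 0 := by omega
    have h2 : (i.val + 1) / 2 = i.val / 2 + 1 := by omega
    have := hyx ⟨i.val / 2, by omega⟩
    simpa [mcPts, h, h1, h2] using this

/-- The bordered matrix. -/
noncomputable def mcBig (n : ℕ) (z : Fin (n + 1 + 1) → ℝ) :
    Matrix (Fin (n + 1 + 1)) (Fin (n + 1 + 1)) ℝ :=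
  Matrix.of fun i j =>
    if i.val = 0 then 1 else if i.val = 1 then (if j.val % 2 = 0 then 0 else 1)
    else z j ^ (i.val - 1)

lemma mcBig_det_pos (n : ℕ) (z : Fin (n + 1 + 1) → ℝ) (hz : StrictMono z) :
    0 < (mcBig n z).det := by
  have hv : ∀ j : Fin (n + 1 + 1),
      0 < ((mcBig n z).submatrix (Fin.succAbove 1) j.succAbove).det := by
    intro j
    have : (mcBig n z).submatrix (Fin.succAbove 1) j.succAbove
        = (Matrix.vandermonde (z ∘ j.succAbove)).transpose := by
      ext a b
      refine Fin.cases ?_ (fun a => ?_) a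
      · simp [mcBig, Matrix.vandermonde_apply]
      · have : (Fin.succAbove (1 : Fin (n + 1 + 1)) a.succ) = a.succ.succ := by
          rw [Fin.succAbove_of_le_castSucc]
          simp [Fin.le_def]
        simp [mcBig, Matrix.vandermonde_apply, this]
    rw [this, Matrix.det_transpose, Matrix.det_vandermonde]
    refine Finset.prod_pos fun a _ => Finset.prod_pos fun b hb => ?_
    have hab : a < b := by simpa using hb
    exact sub_pos.2 (hz (Fin.strictMono_succAbove j hab))
  rw [Matrix.det_succ_row _ 1]
  have key : ∀ j : Fin (n + 1 + 1), (-1 : ℝ) ^ (((1 : Fin (n + 1 + 1)) : ℕ) + (j : ℕ)) *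
      mcBig n z 1 j = if j.val % 2 = 0 then 0 else 1 := by
    intro j
    rcases Nat.mod_two_eq_zero_or_one j.val with h | h
    · simp [mcBig, h]
    · have : Even (1 + j.val) := by rw [Nat.even_iff]; omega
      simp [mcBig, h, this.neg_one_pow]
  refine Finset.sum_pos' (fun j _ => ?_) ⟨1, Finset.mem_univ _, ?_⟩
  · rw [key]
    split_ifs
    · simp
    · simpa using (hv j).le
  · rw [key]
    simpa using hv 1

/-- Column operations. -/
noncomputable def mcU (n : ℕ) : Matrix (Fin (n + 1 + 1)) (Fin (n + 1 + 1)) ℝ :=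
  Matrix.of fun l j => (if l = j then 1 else 0) +
    (if l = (⟨j.val % 2, by omega⟩ : Fin (n + 1 + 1)) then (if 2 ≤ j.val then 1 else 0) else 0)

lemma mcU_det (n : ℕ) : (mcU n).det = 1 := by
  rw [Matrix.det_of_upperTriangular]
  · refine Finset.prod_eq_one fun i _ => ?_
    simp only [mcU, Matrix.of_apply, Fin.ext_iff]
    split_ifs <;> first | omega | simp
  · intro i j hij
    have hij : j.val < i.val := hij
    simp only [mcU, Matrix.of_apply, Fin.ext_iff]
    split_ifs <;> first | omega | simp

lemma mcBig_det (n : ℕ) (z : Fin (n + 1 + 1) → ℝ) :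
    (mcBig n z).det = (Matrix.of fun i j : Fin n =>
      z j.succ.succ ^ (i.val + 1) - z ⟨j.val % 2, by omega⟩ ^ (i.val + 1)).det := by
  let M' : Matrix (Fin (n + 1 + 1)) (Fin (n + 1 + 1)) ℝ := Matrix.of fun i j =>
    mcBig n z i j - if 2 ≤ j.val then mcBig n z i ⟨j.val % 2, by omega⟩ else 0
  have hM : mcBig n z = M' * mcU n := by
    ext i j
    simp only [Matrix.mul_apply, mcU, Matrix.of_apply, mul_add, Finset.sum_add_distrib,
      mul_ite, mul_one, mul_zero, Finset.sum_ite_eq', Finset.sum_ite_eq, Finset.mem_univ, if_true]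
    have : ¬ 2 ≤ j.val % 2 := by omega
    simp only [M', Matrix.of_apply, this, if_false]
    split_ifs <;> ring
  have h0 : ∀ j : Fin n, M' 0 j.succ.succ = 0 := by
    intro j; simp [M', mcBig]
  have h1 : ∀ j : Fin n, M' 1 j.succ.succ = 0 := by
    intro j; simp [M', mcBig]
  have h00 : M' 0 0 = 1 := by simp [M', mcBig]
  have h10 : M' 1 0 = 0 := by simp [M', mcBig]
  have h11 : M' 1 1 = 1 := by simp [M', mcBig]
  rw [hM, Matrix.det_mul, mcU_det, mul_one, Matrix.det_succ_row_zero, Fin.sum_univ_succ,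
    Fin.sum_univ_succ]
  have hz : (M'.submatrix Fin.succ (Fin.succAbove (Fin.succ 0))).det = 0 := by
    apply Matrix.det_eq_zero_of_row_eq_zero 0
    intro j
    refine Fin.cases ?_ (fun j => ?_) j
    · simpa using h10
    · simpa using h1 j
  rw [hz]
  simp only [h0, mul_zero, zero_mul, Finset.sum_const_zero, add_zero, h00]
  rw [Matrix.det_succ_row_zero, Fin.sum_univ_succ]
  simp [h1, h11]
  congr 1
  ext i j
  have hj : (j.val + 1 + 1) % 2 = j.val % 2 := by omega
  simp [M', mcBig, hj]


/-- For reals `x₀ < y₀ < x₁ < y₁ < ⋯ < x_k < y_k`, the determinant of the `2k × 2k` matrix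
with columns (in this order) `γ(x₁)−γ(x₀), γ(y₁)−γ(y₀), …, γ(x_k)−γ(x₀), γ(y_k)−γ(y₀)`,
where `γ` is the moment curve in `ℝ^{2k}`, is strictly positive. -/
theorem momentCurve_interleaved_det_pos (k : ℕ) (hk : 1 ≤ k)
    (x y : Fin (k + 1) → ℝ)
    (hxy : ∀ i, x i < y i)
    (hyx : ∀ i : Fin k, y i.castSucc < x i.succ) :
    0 < Matrix.det (Matrix.of fun (i j : Fin (2 * k)) =>
      if j.val % 2 = 0 then
        momentCurve (2 * k) (x ⟨j.val / 2 + 1, by have := j.isLt; omega⟩) i -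
          momentCurve (2 * k) (x 0) i
      else
        momentCurve (2 * k) (y ⟨j.val / 2 + 1, by have := j.isLt; omega⟩) i -
          momentCurve (2 * k) (y 0) i) := by
  have h := mcBig_det_pos (2 * k) (mcPts k x y) (mcPts_strictMono k x y hxy hyx)
  rw [mcBig_det] at h
  convert h using 2
  ext i j
  have h2 : (j.val + 1 + 1) / 2 = j.val / 2 + 1 := by omega
  rcases Nat.mod_two_eq_zero_or_one j.val with h' | h'
  · have h1 : (j.val + 1 + 1) % 2 = 0 := by omega
    simp [momentCurve, mcPts, h', h1, h2]
  · have h1 : (j.val + 1 + 1) % 2 = 1 := by omega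
    simp [momentCurve, mcPts, h', h1, h2]
end

section
/- Let V be a finite vertex set and let K be a finite set of 3-element subsets of V (the triangles of a 2-dimensional simplicial complex) such that every 2-element subset e ⊆ V (edge) is contained in at most two triangles of K. Call a nonempty subset C ⊆ K a homological cycle (with ℤ₂ coefficients) if every edge e is contained in an even number of triangles of C. Let the dual graph of K be the simple graph on vertex set K in which two triangles are adjacent if and only if they share an edge (a common 2-element subset). Then every inclusion-minimal homological cycle C ⊆ K is exactly the vertex set of a connected component of the dual graph of K. -/
/-- The dual graph of a 2-dimensional simplicial complex given by its set `K` of triangles: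
vertices are the triangles, and two triangles are adjacent iff they share an edge
(a common 2-element subset). -/
def dualGraph {V : Type*} [DecidableEq V] (K : Finset (Finset V)) :
    SimpleGraph {t : Finset V // t ∈ K} where
  Adj t t' := t ≠ t' ∧ ∃ e : Finset V, e.card = 2 ∧ e ⊆ t.1 ∧ e ⊆ t'.1
  symm := by
    refine ⟨?_⟩
    rintro t t' ⟨hne, e, hc, h1, h2⟩
    exact ⟨hne.symm, e, hc, h2, h1⟩
  loopless := by
    refine ⟨?_⟩
    rintro t ⟨hne, -⟩
    exact hne rfl

/-- Appendix A: if every edge is contained in at most two triangles of `K`, then every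
inclusion-minimal homological cycle with `ℤ₂` coefficients (a nonempty set `C` of triangles
such that every edge lies in an even number of triangles of `C`) is exactly the vertex set
of a connected component of the dual graph of `K`. -/
theorem minimal_homological_cycle_is_component {V : Type*} [Fintype V] [DecidableEq V]
    (K : Finset (Finset V))
    (htri : ∀ t ∈ K, t.card = 3)
    (hedge : ∀ e : Finset V, e.card = 2 → (K.filter (fun t => e ⊆ t)).card ≤ 2)
    (C : Finset (Finset V)) (hCK : C ⊆ K) (hCne : C.Nonempty)
    (hcyc : ∀ e : Finset V, e.card = 2 → Even ((C.filter (fun t => e ⊆ t)).card))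
    (hmin : ∀ C' ⊆ C, C'.Nonempty →
      (∀ e : Finset V, e.card = 2 → Even ((C'.filter (fun t => e ⊆ t)).card)) → C' = C) :
    ∃ c : (dualGraph K).ConnectedComponent,
      ∀ t : {t : Finset V // t ∈ K},
        t.1 ∈ C ↔ (dualGraph K).connectedComponentMk t = c := by
  classical
  obtain ⟨t0, ht0⟩ := hCne
  have hadj : ∀ a b : {t : Finset V // t ∈ K}, (dualGraph K).Adj a b → a.1 ∈ C → b.1 ∈ C := by
    rintro a b ⟨_, e, he, hea, heb⟩ haC
    have hsub : C.filter (fun t => e ⊆ t) ⊆ K.filter (fun t => e ⊆ t) :=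
      Finset.filter_subset_filter _ hCK
    have hpos : 0 < (C.filter (fun t => e ⊆ t)).card :=
      Finset.card_pos.mpr ⟨a.1, Finset.mem_filter.mpr ⟨haC, hea⟩⟩
    obtain ⟨k, hk⟩ := hcyc e he
    have heq := Finset.eq_of_subset_of_card_le hsub (by have := hedge e he; omega)
    have hb : b.1 ∈ K.filter (fun t => e ⊆ t) := Finset.mem_filter.mpr ⟨b.2, heb⟩
    rw [← heq] at hb
    exact (Finset.mem_filter.mp hb).1
  have hreach : ∀ a b : {t : Finset V // t ∈ K}, (dualGraph K).Reachable a b →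
      a.1 ∈ C → b.1 ∈ C := by
    rintro a b ⟨w⟩
    induction w with
    | nil => exact id
    | cons h _ ih => exact fun ha => ih (hadj _ _ h ha)
  let c := (dualGraph K).connectedComponentMk ⟨t0, hCK ht0⟩
  have hC' := hmin (C.filter (fun s => ∃ h : s ∈ K, (dualGraph K).connectedComponentMk ⟨s, h⟩ = c))
    (Finset.filter_subset _ _) ⟨t0, Finset.mem_filter.mpr ⟨ht0, hCK ht0, rfl⟩⟩ (by
      intro e he
      by_cases hex : ∃ s ∈ C, e ⊆ s ∧ ∃ h : s ∈ K, (dualGraph K).connectedComponentMk ⟨s, h⟩ = c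
      · obtain ⟨s, hsC, hes, hsK, hs⟩ := hex
        have hE : (C.filter (fun s => ∃ h : s ∈ K,
            (dualGraph K).connectedComponentMk ⟨s, h⟩ = c)).filter (fun t => e ⊆ t)
            = C.filter (fun t => e ⊆ t) := by
          ext u
          simp only [Finset.mem_filter]
          refine ⟨fun h => ⟨h.1.1, h.2⟩, fun h => ⟨⟨h.1, hCK h.1, ?_⟩, h.2⟩⟩
          rw [← hs]
          by_cases hus : u = s
          · subst hus; rfl
          · apply SimpleGraph.ConnectedComponent.sound
            apply SimpleGraph.Adj.reachable
            exact ⟨fun h' => hus (congrArg Subtype.val h'), e, he, h.2, hes⟩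
        rw [hE]
        exact hcyc e he
      · have hE : (C.filter (fun s => ∃ h : s ∈ K,
            (dualGraph K).connectedComponentMk ⟨s, h⟩ = c)).filter (fun t => e ⊆ t) = ∅ := by
          ext u
          simp only [Finset.mem_filter, Finset.notMem_empty, iff_false]
          exact fun h => hex ⟨u, h.1.1, h.2, h.1.2⟩
        rw [hE]
        simp)
  refine ⟨c, fun t => ⟨fun ht => ?_, fun ht => ?_⟩⟩
  · rw [← hC'] at ht
    exact (Finset.mem_filter.mp ht).2.2
  · exact hreach _ _ (SimpleGraph.ConnectedComponent.exact ht.symm) ht0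
end
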